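/- Let (X, μ) be a probability space, let φ : X → X be measure-preserving, let 1 ≤ p < ∞, and let T_φ be the composition operator on L^p(X, μ; ℂ). Then the following are equivalent: (i) 1 is isolated in the spectrum σ(T_φ); (ii) T_φ is uniformly almost periodic; (iii) T_φ is uniformly mean ergodic. -/

import Mathlib

open MeasureTheory Filter
open scoped ENNReal

/-- The composition (Koopman) operator `f ↦ f ∘ φ` on `L^p(X, μ; ℂ)` for a
measure-preserving map `φ`. -/
noncomputable def lpKoopman (p : ℝ≥0∞) [Fact (1 ≤ p)] {X : Type*} [MeasurableSpace X]
    (μ : Measure X) (φ : X → X) (hφ : MeasurePreserving φ μ μ) :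
    Lp ℂ p μ →L[ℂ] Lp ℂ p μ :=
  (MeasureTheory.Lp.compMeasurePreservingₗᵢ ℂ φ hφ).toContinuousLinearMap

/-- A bounded operator `S` is periodic if `S ^ (n + N) = S ^ n` for some `N ≥ 1` and all
`n ≥ 1`. -/
def OperatorPeriodic {E : Type*} [NormedAddCommGroup E] [NormedSpace ℂ E]
    (S : E →L[ℂ] E) : Prop :=
  ∃ N ≥ 1, ∀ n ≥ 1, S ^ (n + N) = S ^ n

/-- A bounded operator `T` is uniformly almost periodic if there is a periodic bounded
operator `S` with `‖T ^ n - S ^ n‖ → 0`. -/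
def UniformlyAlmostPeriodic {E : Type*} [NormedAddCommGroup E] [NormedSpace ℂ E]
    (T : E →L[ℂ] E) : Prop :=
  ∃ S : E →L[ℂ] E, OperatorPeriodic S ∧ Tendsto (fun n : ℕ => ‖T ^ n - S ^ n‖) atTop (nhds 0)

/-- A bounded operator is uniformly mean ergodic if its Cesàro averages converge in
operator norm. -/
def UniformlyMeanErgodic {E : Type*} [NormedAddCommGroup E] [NormedSpace ℂ E]
    (T : E →L[ℂ] E) : Prop :=
  ∃ P : E →L[ℂ] E,
    Tendsto (fun n : ℕ => ‖(n : ℂ)⁻¹ • (∑ k ∈ Finset.range n, T ^ k) - P‖) atTop (nhds 0)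

/-- If `k ∣ N`, every nonnull measurable subset of `B \ φ^[N] ⁻¹' B` contains a nonnull measurable
set which is disjoint from its preimage under `φ^[k]`. -/
lemma exists_subset_disjoint_preimage_iterate {X : Type*} [MeasurableSpace X] {μ : Measure X}
    {φ : X → X} (hφ : Measurable φ) {B D : Set X} (hB : MeasurableSet B) (hD : MeasurableSet D)
    {k N : ℕ} (hk : k ∣ N) (hDB : D ⊆ B \ φ^[N] ⁻¹' B) (hμD : μ D ≠ 0) :
    ∃ D' ⊆ D, MeasurableSet D' ∧ μ D' ≠ 0 ∧ Disjoint D' (φ^[k] ⁻¹' D') := by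
  by_contra! H
  have key : ∀ C, MeasurableSet C → μ (D ∩ (C \ φ^[k] ⁻¹' C)) = 0 := by
    intro C hC
    by_contra hne
    refine H _ Set.inter_subset_left (hD.inter (hC.diff (hφ.iterate k hC))) hne ?_
    rw [Set.disjoint_left]
    rintro x ⟨-, -, hx⟩ ⟨-, hx', -⟩
    exact hx hx'
  have key' : ∀ C, MeasurableSet C → ∀ᵐ x ∂μ, x ∈ D → (x ∈ C ↔ φ^[k] x ∈ C) := by
    intro C hC
    filter_upwards [measure_eq_zero_iff_ae_notMem.1 (key C hC),
      measure_eq_zero_iff_ae_notMem.1 (key Cᶜ hC.compl)] with x h₁ h₂ hx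
    simp only [Set.mem_inter_iff, Set.mem_sdiff, Set.mem_preimage, Set.mem_compl_iff] at h₁ h₂
    tauto
  have iter : ∀ j, ∀ᵐ x ∂μ, x ∈ D → (x ∈ B ↔ φ^[j * k] x ∈ B) := by
    intro j
    induction j with
    | zero => simp
    | succ j ih =>
      filter_upwards [ih, key' _ (hφ.iterate (j * k) hB)] with x h₁ h₂ hx
      rw [add_mul, one_mul, Function.iterate_add_apply, h₁ hx]
      exact h₂ hx
  obtain ⟨j, rfl⟩ := hk
  refine hμD (measure_eq_zero_iff_ae_notMem.2 ?_)
  filter_upwards [iter j] with x h hx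
  have := hDB hx
  rw [mul_comm k j] at this
  exact this.2 ((h hx).1 this.1)

/-- If `φ^[n !]` does not act trivially on measurable sets, there is a nonnull measurable set which
is disjoint from its first `n` preimages. -/
lemma exists_forall_disjoint_preimage_iterate {X : Type*} [MeasurableSpace X] {μ : Measure X}
    {φ : X → X} (hφ : Measurable φ) {n : ℕ} {B : Set X} (hB : MeasurableSet B)
    (hμB : μ (B \ φ^[n.factorial] ⁻¹' B) ≠ 0) :
    ∃ A, MeasurableSet A ∧ μ A ≠ 0 ∧
      ∀ k, 1 ≤ k → k ≤ n → Disjoint A (φ^[k] ⁻¹' A) := by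
  suffices H : ∀ m ≤ n, ∃ A ⊆ B \ φ^[n.factorial] ⁻¹' B, MeasurableSet A ∧ μ A ≠ 0 ∧
      ∀ k, 1 ≤ k → k ≤ m → Disjoint A (φ^[k] ⁻¹' A) by
    obtain ⟨A, -, hA⟩ := H n le_rfl
    exact ⟨A, hA⟩
  intro m
  induction m with
  | zero =>
    exact fun _ => ⟨_, subset_rfl, hB.diff (hφ.iterate _ hB), hμB, fun k h₁ h₂ => by omega⟩
  | succ m ih =>
    intro hm
    obtain ⟨A, hAB, hA, hμA, hdis⟩ := ih (by omega)
    obtain ⟨A', hA'A, hA', hμA', hdis'⟩ := exists_subset_disjoint_preimage_iterate hφ hB hA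
      (Nat.dvd_factorial m.succ_pos hm) hAB hμA
    refine ⟨A', hA'A.trans hAB, hA', hμA', fun k h₁ h₂ => ?_⟩
    rcases Nat.le_succ_iff.1 h₂ with h | rfl
    · exact (hdis k h₁ h).mono hA'A (Set.preimage_mono hA'A)
    · exact hdis'

section lpKoopman

variable {X : Type*} [MeasurableSpace X] {μ : Measure X} {p : ℝ≥0∞} [Fact (1 ≤ p)]
  {φ : X → X} (hφ : MeasurePreserving φ μ μ)

lemma norm_lpKoopman_pow_apply (n : ℕ) (f : Lp ℂ p μ) :
    ‖(lpKoopman p μ φ hφ ^ n) f‖ = ‖f‖ := by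
  induction n with
  | zero => simp
  | succ n ih =>
    rw [pow_succ', mul_apply_eq_comp, ← ih]
    exact Lp.norm_compMeasurePreserving _ hφ

lemma lpKoopman_pow_indicatorConstLp (n : ℕ) {s : Set X} (hs : MeasurableSet s) (hμs : μ s ≠ ∞)
    (c : ℂ) :
    (lpKoopman p μ φ hφ ^ n) (indicatorConstLp p hs hμs c) =
      indicatorConstLp p ((hφ.iterate n).measurable hs)
        (by rwa [(hφ.iterate n).measure_preimage hs.nullMeasurableSet]) c := by
  rw [← Lp.indicatorConstLp_compMeasurePreserving hs hμs c (hφ.iterate n),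
    ← Lp.compMeasurePreserving_iterate, FunLike.coe_pow_eq_iterate]
  rfl

lemma lpKoopman_pow_eq_one [IsFiniteMeasure μ] (hp : p ≠ ∞) {N : ℕ}
    (h : ∀ B, MeasurableSet B → μ (B \ φ^[N] ⁻¹' B) = 0) :
    lpKoopman p μ φ hφ ^ N = 1 := by
  ext1 f
  induction f using Lp.induction hp with
  | indicatorConst c hs hμs =>
    rename_i s
    rw [Lp.simpleFunc.coe_indicatorConst, lpKoopman_pow_indicatorConstLp]
    refine Lp.ext ?_
    filter_upwards [indicatorConstLp_coeFn (p := p) (hs := hs) (hμs := hμs.ne) (c := c),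
      indicatorConstLp_coeFn (p := p) (hs := (hφ.iterate N).measurable hs)
        (hμs := measure_ne_top μ _) (c := c), measure_eq_zero_iff_ae_notMem.1 (h s hs),
      measure_eq_zero_iff_ae_notMem.1 (h sᶜ hs.compl)] with x h₁ h₂ h₃ h₄
    rw [h₂, one_apply_eq_self, h₁]
    have : φ^[N] x ∈ s ↔ x ∈ s := by
      simp only [Set.mem_sdiff, Set.mem_preimage, Set.mem_compl_iff] at h₃ h₄
      tauto
    by_cases hx : x ∈ s <;> simp [Set.indicator, hx, this]
  | add hf hg _ h₁ h₂ => rw [map_add, map_add, h₁, h₂]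
  | isClosed =>
    exact isClosed_eq (ContinuousLinearMap.continuous _) (ContinuousLinearMap.continuous _)

/-- If `A` is disjoint from its first `n` preimages, then a unimodular `l` is an approximate
eigenvalue of the Koopman operator up to an error `2 / n ^ (1 / p)`. -/
lemma exists_approx_eigenvector_lpKoopman [IsFiniteMeasure μ] (hp : p ≠ ∞) {n : ℕ} {A : Set X}
    (hA : MeasurableSet A) (hμA : μ A ≠ 0)
    (hdis : ∀ k, 1 ≤ k → k ≤ n → Disjoint A (φ^[k] ⁻¹' A)) {l : ℂ} (hl : ‖l‖ = 1) :
    ∃ c > 0, ∃ f : Lp ℂ p μ, (n : ℝ) ^ (1 / p.toReal) * c ≤ ‖f‖ ∧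
      ‖l • f - lpKoopman p μ φ hφ f‖ ≤ 2 * c := by
  have hp0 : p ≠ 0 := (zero_lt_one.trans_le Fact.out).ne'
  have hl0 : l ≠ 0 := norm_ne_zero_iff.1 (by simp [hl])
  set T := lpKoopman p μ φ hφ
  set h : Lp ℂ p μ := indicatorConstLp p hA (measure_ne_top μ A) 1 with hh
  have hnorm : ‖h‖ = μ.real A ^ (1 / p.toReal) := by
    simp [hh, norm_indicatorConstLp hp0 hp]
  refine ⟨‖h‖, ?_, ∑ k ∈ Finset.range n, (l⁻¹) ^ k • (T ^ k) h, ?_, ?_⟩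
  · rw [hnorm]
    exact Real.rpow_pos_of_pos (ENNReal.toReal_pos hμA (measure_ne_top μ A)) _
  · have hpd : Set.PairwiseDisjoint (Finset.range n : Set ℕ) fun k => φ^[k] ⁻¹' A := by
      suffices H : ∀ i j, i < j → j < n → Disjoint (φ^[i] ⁻¹' A) (φ^[j] ⁻¹' A) by
        intro i hi j hj hij
        simp only [Finset.coe_range, Set.mem_Iio] at hi hj
        rcases lt_or_gt_of_ne hij with hij | hij
        · exact H i j hij hj
        · exact (H j i hij hi).symm
      intro i j hij hj
      have := (hdis (j - i) (by omega) (by omega)).preimage φ^[i]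
      rwa [← Set.preimage_comp, ← Function.iterate_add, Nat.sub_add_cancel hij.le] at this
    have hmeas : ∀ k, MeasurableSet (φ^[k] ⁻¹' A) := fun k => (hφ.iterate k).measurable hA
    set U := ⋃ k ∈ Finset.range n, φ^[k] ⁻¹' A with hU
    have hUm : MeasurableSet U := Finset.measurableSet_biUnion _ fun k _ => hmeas k
    have hμU : μ.real U = n * μ.real A := by
      rw [hU, measureReal_biUnion_finset hpd fun k _ => hmeas k]
      simp [measureReal_def, (hφ.iterate _).measure_preimage hA.nullMeasurableSet]
    have hnU : ‖indicatorConstLp p hUm (measure_ne_top μ U) (1 : ℂ)‖ =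
        (n : ℝ) ^ (1 / p.toReal) * ‖h‖ := by
      rw [norm_indicatorConstLp hp0 hp, hμU, hnorm, norm_one, one_mul,
        Real.mul_rpow (Nat.cast_nonneg _) measureReal_nonneg]
    rw [← hnU]
    refine Lp.norm_le_norm_of_ae_le ?_
    have hall : ∀ᵐ x ∂μ, ∀ k : ℕ, (((l⁻¹) ^ k • (T ^ k) h : Lp ℂ p μ) : X → ℂ) x =
        (φ^[k] ⁻¹' A).indicator (fun _ => (l⁻¹) ^ k) x := by
      refine ae_all_iff.2 fun k => ?_
      rw [hh, lpKoopman_pow_indicatorConstLp]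
      filter_upwards [Lp.coeFn_smul ((l⁻¹) ^ k) (indicatorConstLp p (hmeas k)
        (measure_ne_top μ _) (1 : ℂ)), indicatorConstLp_coeFn (p := p) (hs := hmeas k)
        (hμs := measure_ne_top μ _) (c := (1 : ℂ))] with x h₁ h₂
      rw [h₁, Pi.smul_apply, h₂]
      by_cases hx : x ∈ φ^[k] ⁻¹' A
      · rw [Set.indicator_of_mem hx, Set.indicator_of_mem hx, smul_eq_mul, mul_one]
      · rw [Set.indicator_of_notMem hx, Set.indicator_of_notMem hx, smul_zero]
    filter_upwards [hall, indicatorConstLp_coeFn (p := p) (hs := hUm)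
      (hμs := measure_ne_top μ U) (c := (1 : ℂ)),
      Lp.coeFn_finsetSum (Finset.range n) (fun k => (l⁻¹) ^ k • (T ^ k) h)] with x h₁ h₂ h₃
    rw [h₂, h₃, Finset.sum_apply]
    by_cases hx : x ∈ U
    · obtain ⟨i, hi, hxi⟩ := Set.mem_iUnion₂.1 hx
      rw [Finset.sum_eq_single_of_mem i hi, h₁, Set.indicator_of_mem hxi, Set.indicator_of_mem hx]
      · simp [hl]
      · intro j hj hji
        rw [h₁, Set.indicator_of_notMem]
        exact fun hxj => Set.disjoint_left.1 (hpd hj hi hji) hxj hxi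
    · rw [Set.indicator_of_notMem hx, norm_zero]
      exact norm_nonneg _
  · have htel : l • (∑ k ∈ Finset.range n, (l⁻¹) ^ k • (T ^ k) h) -
        T (∑ k ∈ Finset.range n, (l⁻¹) ^ k • (T ^ k) h) =
        l • h - (l * (l⁻¹) ^ n) • (T ^ n) h := by
      have := Finset.sum_range_sub' (fun k => (l * (l⁻¹) ^ k) • (T ^ k) h) n
      simp only [pow_zero, mul_one, one_apply_eq_self] at this
      rw [← this, map_sum, Finset.smul_sum, ← Finset.sum_sub_distrib]
      refine Finset.sum_congr rfl fun k _ => ?_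
      rw [map_smul, smul_smul, pow_succ' T, mul_apply_eq_comp, pow_succ' l⁻¹,
        mul_inv_cancel_left₀ hl0]
    rw [htel]
    refine (norm_sub_le _ _).trans ?_
    rw [norm_smul, norm_smul, norm_lpKoopman_pow_apply]
    simp [hl, two_mul]

/-- If no power of the Koopman operator is the identity, its spectrum contains the unit circle. -/
lemma mem_spectrum_lpKoopman [IsFiniteMeasure μ] (hp : p ≠ ∞)
    (hper : ∀ N ≥ 1, lpKoopman p μ φ hφ ^ N ≠ 1) {l : ℂ} (hl : ‖l‖ = 1) :
    l ∈ spectrum ℂ (lpKoopman p μ φ hφ) := by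
  rw [spectrum.mem_iff]
  rintro ⟨u, hu⟩
  have hp0 : 0 < p.toReal := ENNReal.toReal_pos (zero_lt_one.trans_le Fact.out).ne' hp
  set K := ‖((u⁻¹ : (Lp ℂ p μ →L[ℂ] Lp ℂ p μ)ˣ) : Lp ℂ p μ →L[ℂ] Lp ℂ p μ)‖
  have hbound : ∀ n : ℕ, (n : ℝ) ^ (1 / p.toReal) ≤ 2 * K := by
    intro n
    obtain ⟨B, hB, hμB⟩ : ∃ B, MeasurableSet B ∧ μ (B \ φ^[n.factorial] ⁻¹' B) ≠ 0 := by
      by_contra! H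
      exact hper _ (Nat.one_le_iff_ne_zero.2 n.factorial_ne_zero) (lpKoopman_pow_eq_one hφ hp H)
    obtain ⟨A, hA, hμA, hdis⟩ := exists_forall_disjoint_preimage_iterate hφ.measurable hB hμB
    obtain ⟨c, hc, f, hf₁, hf₂⟩ := exists_approx_eigenvector_lpKoopman hφ hp hA hμA hdis hl
    have hf : f = (u⁻¹ : (Lp ℂ p μ →L[ℂ] Lp ℂ p μ)ˣ).1 (l • f - lpKoopman p μ φ hφ f) := by
      have : l • f - lpKoopman p μ φ hφ f = u.1 f := by
        rw [hu, Algebra.algebraMap_eq_smul_one]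
        rfl
      rw [this, ← mul_apply_eq_comp, Units.inv_mul, one_apply_eq_self]
    have hle : ‖f‖ ≤ K * (2 * c) := by
      calc ‖f‖ = _ := congrArg norm hf
        _ ≤ K * ‖l • f - lpKoopman p μ φ hφ f‖ := ContinuousLinearMap.le_opNorm _ _
        _ ≤ K * (2 * c) := by gcongr
    exact le_of_mul_le_mul_right (by linarith) hc
  have htend : Tendsto (fun n : ℕ => (n : ℝ) ^ (1 / p.toReal)) atTop atTop :=
    (tendsto_rpow_atTop (by positivity)).comp tendsto_natCast_atTop_atTop
  obtain ⟨n, hn⟩ := (htend.eventually_gt_atTop (2 * K)).exists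
  exact absurd (hbound n) (not_le.2 hn)

end lpKoopman

/-- The primitive roots of unity `exp (2πi / n)` converge to `1`. -/
lemma tendsto_exp_two_pi_I_div :
    Tendsto (fun n : ℕ => Complex.exp (2 * Real.pi * Complex.I / n)) atTop (nhds 1) := by
  rw [← Complex.exp_zero]
  exact (Complex.continuous_exp.tendsto 0).comp (tendsto_const_div_atTop_nhds_zero_nat _)

lemma UniformlyMeanErgodic.of_pow_eq_one {E : Type*} [NormedAddCommGroup E] [NormedSpace ℂ E]
    {T : E →L[ℂ] E} {N : ℕ} (hN : 1 ≤ N) (hT : T ^ N = 1) : UniformlyMeanErgodic T := by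
  have hN0 : (N : ℂ) ≠ 0 := by exact_mod_cast (by omega : N ≠ 0)
  set P : E →L[ℂ] E := (N : ℂ)⁻¹ • ∑ k ∈ Finset.range N, T ^ k with hP
  have hNP : (N : ℂ) • P = ∑ k ∈ Finset.range N, T ^ k := by
    rw [hP, smul_inv_smul₀ hN0]
  set c : ℕ → E →L[ℂ] E := fun n => ∑ k ∈ Finset.range n, T ^ k - (n : ℂ) • P with hc
  have hper : Function.Periodic c N := by
    intro n
    simp only [hc]
    rw [add_comm n N, Finset.sum_range_add, Nat.cast_add, add_smul, hNP]
    simp only [pow_add, hT, one_mul]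
    abel
  obtain ⟨M, hM⟩ : ∃ M, ∀ n, ‖c n‖ ≤ M := by
    refine ⟨∑ k ∈ Finset.range N, ‖c k‖, fun n => ?_⟩
    rw [← hper.map_mod_nat n]
    exact Finset.single_le_sum (f := fun k => ‖c k‖) (fun _ _ => norm_nonneg _)
      (Finset.mem_range.2 (Nat.mod_lt _ hN))
  refine ⟨P, squeeze_zero' (Eventually.of_forall fun _ => norm_nonneg _) ?_
    (tendsto_const_div_atTop_nhds_zero_nat M)⟩
  filter_upwards [eventually_ge_atTop 1] with n hn
  have hn0 : (n : ℂ) ≠ 0 := by exact_mod_cast (by omega : n ≠ 0)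
  have : (n : ℂ)⁻¹ • ∑ k ∈ Finset.range n, T ^ k - P = (n : ℂ)⁻¹ • c n := by
    simp only [hc, smul_sub, inv_smul_smul₀ hn0]
  rw [this, norm_smul, norm_inv, Complex.norm_natCast, div_eq_inv_mul]
  gcongr
  exact hM n

lemma norm_exp_two_pi_I_div {n : ℕ} (hn : n ≠ 0) :
    ‖Complex.exp (2 * Real.pi * Complex.I / n)‖ = 1 :=
  (Complex.isPrimitiveRoot_exp n hn).norm'_eq_one hn

/-- If the Cesàro averages of `T` converge in norm, the spectrum of `T` omits a point of the unit
circle. -/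
lemma UniformlyMeanErgodic.exists_notMem_spectrum {E : Type*} [NormedAddCommGroup E]
    [NormedSpace ℂ E] [CompleteSpace E] [Nontrivial E] {T : E →L[ℂ] E}
    (hT : UniformlyMeanErgodic T) : ∃ l : ℂ, ‖l‖ = 1 ∧ l ∉ spectrum ℂ T := by
  by_contra! H
  obtain ⟨P, hP⟩ := hT
  have hcau : CauchySeq fun n : ℕ => (n : ℂ)⁻¹ • ∑ k ∈ Finset.range n, T ^ k :=
    (tendsto_iff_norm_sub_tendsto_zero.2 hP).cauchySeq
  obtain ⟨M, hM⟩ := Metric.cauchySeq_iff.1 hcau (1 / 2) (by norm_num)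
  have hev : ∀ {l : ℂ}, ‖l‖ = 1 → ∀ m ≥ M + 1, ‖(m : ℂ)⁻¹ * ∑ k ∈ Finset.range m, l ^ k -
      ((M + 1 : ℕ) : ℂ)⁻¹ * ∑ k ∈ Finset.range (M + 1), l ^ k‖ < 1 / 2 := by
    intro l hl m hm
    let q : ℕ → Polynomial ℂ := fun n => (n : ℂ)⁻¹ • ∑ k ∈ Finset.range n, Polynomial.X ^ k
    have hmem := spectrum.subset_polynomial_aeval T (q m - q (M + 1)) ⟨l, H l hl, rfl⟩
    have hnorm := spectrum.norm_le_norm_of_mem hmem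
    have hd := hM m (by omega) (M + 1) (by omega)
    rw [dist_eq_norm] at hd
    simp only [q, map_sub, map_smul, map_sum, map_pow, Polynomial.aeval_X, Polynomial.eval_sub,
      Polynomial.eval_smul, Polynomial.eval_finsetSum, Polynomial.eval_pow, Polynomial.eval_X,
      smul_eq_mul] at hnorm
    exact hnorm.trans_lt hd
  have hlim : Tendsto (fun m : ℕ => ‖((M + 1 : ℕ) : ℂ)⁻¹ * ∑ k ∈ Finset.range (M + 1),
      Complex.exp (2 * Real.pi * Complex.I / m) ^ k‖) atTop (nhds 1) := by
    have := ((tendsto_finsetSum (Finset.range (M + 1))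
      fun k _ => tendsto_exp_two_pi_I_div.pow k).const_mul ((M + 1 : ℕ) : ℂ)⁻¹).norm
    have h0 : ((M + 1 : ℕ) : ℂ) ≠ 0 := by exact_mod_cast M.succ_ne_zero
    simpa only [one_pow, Finset.sum_const, Finset.card_range, nsmul_eq_mul, mul_one,
      inv_mul_cancel₀ h0, norm_one] using this
  obtain ⟨m, hm₁, hm₂, hm₃⟩ := ((hlim.eventually (lt_mem_nhds (by norm_num : (1 / 2 : ℝ) < 1))).and
    ((eventually_ge_atTop 2).and (eventually_ge_atTop (M + 1)))).exists
  have h := hev (norm_exp_two_pi_I_div (by omega : m ≠ 0)) m hm₃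
  rw [(Complex.isPrimitiveRoot_exp m (by omega)).geom_sum_eq_zero (by omega), mul_zero, zero_sub,
    norm_neg] at h
  exact lt_asymm h hm₁

/-- For a measure-preserving map `φ` on a probability space and `1 ≤ p < ∞`, the following
are equivalent for the composition operator `T_φ` on `L^p(X, μ; ℂ)`: (i) `1` is isolated in
`σ(T_φ)`; (ii) `T_φ` is uniformly almost periodic; (iii) `T_φ` is uniformly mean ergodic. -/
theorem lp_tfae_one_isolated_uniformlyAlmostPeriodic_uniformlyMeanErgodic
    {X : Type*} [MeasurableSpace X] (μ : Measure X) [IsProbabilityMeasure μ]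
    (p : ℝ≥0∞) [Fact (1 ≤ p)] (hp : p ≠ ∞)
    (φ : X → X) (hφ : MeasurePreserving φ μ μ) :
    List.TFAE
      [(1 : ℂ) ∈ spectrum ℂ (lpKoopman p μ φ hφ) ∧
          ∃ ε > 0, ∀ z ∈ spectrum ℂ (lpKoopman p μ φ hφ), z ≠ 1 → ε ≤ ‖z - 1‖,
        UniformlyAlmostPeriodic (lpKoopman p μ φ hφ),
        UniformlyMeanErgodic (lpKoopman p μ φ hφ)] := by
  have hne : indicatorConstLp p MeasurableSet.univ (measure_ne_top μ _) (1 : ℂ) ≠ 0 := by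
    rw [← norm_ne_zero_iff, norm_indicatorConstLp (zero_lt_one.trans_le Fact.out).ne' hp]
    simp
  have : Nontrivial (Lp ℂ p μ) := ⟨⟨_, _, hne⟩⟩
  have h_one_mem : (1 : ℂ) ∈ spectrum ℂ (lpKoopman p μ φ hφ) := by
    rw [spectrum.mem_iff]
    rintro ⟨u, hu⟩
    refine hne ?_
    set h : Lp ℂ p μ := indicatorConstLp p MeasurableSet.univ (measure_ne_top μ _) (1 : ℂ)
    have hfix : lpKoopman p μ φ hφ h = h := by
      simpa [h] using lpKoopman_pow_indicatorConstLp (p := p) hφ 1 MeasurableSet.univ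
        (measure_ne_top μ _) (1 : ℂ)
    have huh : u.1 h = 0 := by
      rw [hu, map_one, sub_apply, one_apply_eq_self, hfix, sub_self]
    calc h = (u⁻¹.1 * u.1) h := by rw [Units.inv_mul, one_apply_eq_self]
      _ = 0 := by rw [mul_apply_eq_comp, huh, map_zero]
  tfae_have 1 → 2 := by
    rintro ⟨-, ε, hε, hgap⟩
    suffices H : ∃ N ≥ 1, lpKoopman p μ φ hφ ^ N = 1 by
      obtain ⟨N, hN, hTN⟩ := H
      exact ⟨lpKoopman p μ φ hφ, ⟨N, hN, fun n _ => by rw [pow_add, hTN, mul_one]⟩, by simp⟩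
    by_contra! H
    have hlim := tendsto_iff_norm_sub_tendsto_zero.1 tendsto_exp_two_pi_I_div
    obtain ⟨m, hm₁, hm₂⟩ := ((hlim.eventually (gt_mem_nhds hε)).and
      (eventually_ge_atTop 2)).exists
    exact not_le.2 hm₁ (hgap _ (mem_spectrum_lpKoopman hφ hp H
      (norm_exp_two_pi_I_div (by omega))) ((Complex.isPrimitiveRoot_exp m (by omega)).ne_one
        (by omega)))
  tfae_have 2 → 3 := by
    rintro ⟨S, ⟨N, hN, hS⟩, hlim⟩
    refine .of_pow_eq_one hN (sub_eq_zero.1 (norm_le_zero_iff.1 ?_))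
    set T := lpKoopman p μ φ hφ
    have hsum := (hlim.comp (tendsto_add_atTop_nat N)).add hlim
    rw [add_zero] at hsum
    refine ge_of_tendsto hsum ?_
    filter_upwards [eventually_ge_atTop 1] with n hn
    refine ContinuousLinearMap.opNorm_le_bound _
      (add_nonneg (norm_nonneg _) (norm_nonneg _)) fun f => ?_
    calc ‖(T ^ N - 1) f‖ = ‖(T ^ n) ((T ^ N - 1) f)‖ := (norm_lpKoopman_pow_apply hφ n _).symm
      _ = ‖((T ^ (n + N) - S ^ (n + N)) - (T ^ n - S ^ n)) f‖ := by
        rw [hS n hn, sub_sub_sub_cancel_right, ← mul_apply_eq_comp, mul_sub, mul_one, pow_add]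
      _ ≤ ‖(T ^ (n + N) - S ^ (n + N)) - (T ^ n - S ^ n)‖ * ‖f‖ :=
        ContinuousLinearMap.le_opNorm _ _
      _ ≤ _ := by
        gcongr
        exact norm_sub_le _ _
  tfae_have 3 → 1 := by
    intro hT
    refine ⟨h_one_mem, ?_⟩
    obtain ⟨N, hN, hTN⟩ : ∃ N ≥ 1, lpKoopman p μ φ hφ ^ N = 1 := by
      by_contra! H
      obtain ⟨l, hl, hl'⟩ := hT.exists_notMem_spectrum
      exact hl' (mem_spectrum_lpKoopman hφ hp H hl)
    have hfin : (spectrum ℂ (lpKoopman p μ φ hφ)).Finite := by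
      refine (Polynomial.nthRoots N (1 : ℂ)).toFinset.finite_toSet.subset fun z hz => ?_
      have hzN := spectrum.pow_image_subset (lpKoopman p μ φ hφ) N ⟨z, hz, rfl⟩
      rw [hTN, spectrum.one_eq] at hzN
      simpa [Polynomial.mem_nthRoots hN] using hzN
    obtain ⟨ε, hε, hball⟩ := Metric.isOpen_iff.1 (hfin.subset Set.sdiff_subset).isClosed.isOpen_compl
      (1 : ℂ) (fun h : (1 : ℂ) ∈ spectrum ℂ (lpKoopman p μ φ hφ) \ {1} => h.2 rfl)
    refine ⟨ε, hε, fun z hz hz1 => ?_⟩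
    by_contra! hlt
    exact hball (mem_ball_iff_norm.2 hlt) ⟨hz, hz1⟩
  tfae_finish
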